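/- In the BIBPA setting, for every k ≥ 1: Φ(x^{k+1}) − Φ(x^k) ≤ Σ_{i=1}^N [ ( |α_i^k|/(σ_i γ_i^k) − (1 − γ_i^k L_i)/γ_i^k )·D_{h_i}(x^{k,i}, x^{k,i−1}) + ( |α_i^k|/(σ_i γ_i^k) )·D_{h_i}(x^{k−1,i}, x^{k−1,i−1}) ]. -/

import Mathlib

open scoped RealInnerProductSpace
open Filter

/-- The `i`-th partial (block) gradient of `h` at `x`. -/
noncomputable def blockGrad {N : ℕ} {n : Fin N → ℕ}
    (h : ((j : Fin N) → EuclideanSpace ℝ (Fin (n j))) → ℝ)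
    (i : Fin N) (x : (j : Fin N) → EuclideanSpace ℝ (Fin (n j))) :
    EuclideanSpace ℝ (Fin (n i)) :=
  gradient (fun z => h (Function.update x i z)) (x i)

/-- The `i`-th block Bregman distance `D_h(x⟨i←w⟩, x)`. -/
noncomputable def blockBreg {N : ℕ} {n : Fin N → ℕ}
    (h : ((j : Fin N) → EuclideanSpace ℝ (Fin (n j))) → ℝ)
    (i : Fin N) (x : (j : Fin N) → EuclideanSpace ℝ (Fin (n j)))
    (w : EuclideanSpace ℝ (Fin (n i))) : ℝ :=
  h (Function.update x i w) - h x - ⟪blockGrad h i x, w - x i⟫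

/-- The `i`-th block Bregman distance `D_h(y, y')` between two points differing
only in their `i`-th block. -/
noncomputable def bregTwo {N : ℕ} {n : Fin N → ℕ}
    (h : ((j : Fin N) → EuclideanSpace ℝ (Fin (n j))) → ℝ)
    (i : Fin N) (y y' : (j : Fin N) → EuclideanSpace ℝ (Fin (n j))) : ℝ :=
  h y - h y' - ⟪blockGrad h i y', y i - y' i⟫

/-- The intermediate BIBPA point `x^{k,m}` whose first `m` blocks come from `x^{k+1}`
and whose remaining blocks come from `x^k`. -/
def interPt {N : ℕ} {n : Fin N → ℕ}
    (x : ℕ → (j : Fin N) → EuclideanSpace ℝ (Fin (n j))) (k m : ℕ) :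
    (j : Fin N) → EuclideanSpace ℝ (Fin (n j)) :=
  fun j => if (j : ℕ) < m then x (k + 1) j else x k j

/-- The BIBPA objective `Φ(x) = f(x) + Σᵢ gᵢ(xᵢ)` with extended-real valued `gᵢ`. -/
noncomputable def Phi {N : ℕ} {n : Fin N → ℕ}
    (f : ((j : Fin N) → EuclideanSpace ℝ (Fin (n j))) → ℝ)
    (g : (i : Fin N) → EuclideanSpace ℝ (Fin (n i)) → EReal)
    (y : (j : Fin N) → EuclideanSpace ℝ (Fin (n j))) : EReal :=
  ((f y : ℝ) : EReal) + ∑ i, g i (y i)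

/-- A convex function lies above its tangent at every point of differentiability. -/
theorem ConvexOn.add_le_of_hasFDerivAt {E : Type*} [NormedAddCommGroup E] [NormedSpace ℝ E]
    {φ : E → ℝ} {φ' : E →L[ℝ] ℝ} {a : E} (hc : ConvexOn ℝ Set.univ φ)
    (hd : HasFDerivAt φ φ' a) (w : E) : φ a + φ' (w - a) ≤ φ w := by
  have hline : ConvexOn ℝ Set.univ (φ ∘ AffineMap.lineMap (k := ℝ) a w) := by
    simpa using hc.comp_affineMap (AffineMap.lineMap (k := ℝ) a w)
  have hderiv : HasDerivAt (φ ∘ AffineMap.lineMap (k := ℝ) a w) (φ' (w - a)) 0 := by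
    refine HasFDerivAt.comp_hasDerivAt (0 : ℝ) ?_ AffineMap.hasDerivAt_lineMap
    simpa using hd
  have hslope := hline.le_slope_of_hasDerivAt (Set.mem_univ 0) (Set.mem_univ 1) one_pos hderiv
  simp only [slope_def_field, Function.comp_apply, AffineMap.lineMap_apply_zero,
    AffineMap.lineMap_apply_one, sub_zero, div_one] at hslope
  linarith

section Block

variable {N : ℕ} {n : Fin N → ℕ}

/-- The block gradient represents the derivative of the corresponding slice. -/
theorem hasFDerivAt_slice {h : ((j : Fin N) → EuclideanSpace ℝ (Fin (n j))) → ℝ}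
    (hd : Differentiable ℝ h) (i : Fin N) (x : (j : Fin N) → EuclideanSpace ℝ (Fin (n j))) :
    HasFDerivAt (fun z => h (Function.update x i z)) (innerSL ℝ (blockGrad h i x)) (x i) := by
  have hslice : DifferentiableAt ℝ (fun z => h (Function.update x i z)) (x i) :=
    (hd _).comp (x i) (hasFDerivAt_update x (x i)).differentiableAt
  exact hslice.hasGradientAt.hasFDerivAt

/-- Block strong convexity bounds the block Bregman distance below. -/
theorem sq_norm_le_blockBreg {h : ((j : Fin N) → EuclideanSpace ℝ (Fin (n j))) → ℝ}
    (hd : Differentiable ℝ h) {i : Fin N} {σ : ℝ}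
    {x : (j : Fin N) → EuclideanSpace ℝ (Fin (n j))}
    (hc : ConvexOn ℝ Set.univ (fun z : EuclideanSpace ℝ (Fin (n i)) =>
      h (Function.update x i z) - σ / 2 * ‖z‖ ^ 2))
    (w : EuclideanSpace ℝ (Fin (n i))) :
    σ / 2 * ‖w - x i‖ ^ 2 ≤ blockBreg h i x w := by
  have hderiv := (hasFDerivAt_slice hd i x).sub
    ((hasStrictFDerivAt_norm_sq (x i)).hasFDerivAt.const_mul (σ / 2))
  have htangent := hc.add_le_of_hasFDerivAt hderiv w
  have hnorm : ‖w‖ ^ 2 = ‖x i‖ ^ 2 + 2 * ⟪x i, w - x i⟫ + ‖w - x i‖ ^ 2 := by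
    rw [← norm_add_sq_real, add_sub_cancel]
  simp only [Function.update_eq_self, sub_apply,
    smul_apply, innerSL_apply_apply, smul_eq_mul, nsmul_eq_mul,
    Nat.cast_ofNat] at htangent
  rw [hnorm] at htangent
  unfold blockBreg
  linarith

/-- The block descent lemma under relative smoothness. -/
theorem le_add_blockBreg_of_relSmooth {f h : ((j : Fin N) → EuclideanSpace ℝ (Fin (n j))) → ℝ}
    (hf : Differentiable ℝ f) (hd : Differentiable ℝ h) {i : Fin N} {L : ℝ}
    {x : (j : Fin N) → EuclideanSpace ℝ (Fin (n j))}
    (hc : ConvexOn ℝ Set.univ (fun z : EuclideanSpace ℝ (Fin (n i)) =>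
      L * h (Function.update x i z) - f (Function.update x i z)))
    (w : EuclideanSpace ℝ (Fin (n i))) :
    f (Function.update x i w) ≤ f x + ⟪blockGrad f i x, w - x i⟫ + L * blockBreg h i x w := by
  have hderiv := ((hasFDerivAt_slice hd i x).const_mul L).sub (hasFDerivAt_slice hf i x)
  have htangent := hc.add_le_of_hasFDerivAt hderiv w
  simp only [Function.update_eq_self, sub_apply,
    smul_apply, innerSL_apply_apply, smul_eq_mul] at htangent
  unfold blockBreg
  linarith

theorem interPt_apply_self (x : ℕ → (j : Fin N) → EuclideanSpace ℝ (Fin (n j))) (k : ℕ)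
    (i : Fin N) : interPt x k i i = x k i := by
  simp [interPt]

theorem interPt_zero (x : ℕ → (j : Fin N) → EuclideanSpace ℝ (Fin (n j))) (k : ℕ) :
    interPt x k 0 = x k := by
  funext j
  simp [interPt]

theorem interPt_card (x : ℕ → (j : Fin N) → EuclideanSpace ℝ (Fin (n j))) (k : ℕ) :
    interPt x k N = x (k + 1) := by
  funext j
  simp [interPt]

theorem interPt_succ (x : ℕ → (j : Fin N) → EuclideanSpace ℝ (Fin (n j))) (k : ℕ)
    (i : Fin N) : interPt x k (i + 1) = Function.update (interPt x k i) i (x (k + 1) i) := by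
  funext j
  rcases eq_or_ne j i with rfl | hji
  · simp [interPt]
  · have hlt : (j : ℕ) < i + 1 ↔ (j : ℕ) < i := by
      have := Fin.val_ne_of_ne hji
      omega
    simp [interPt, hji, hlt]

theorem bregTwo_interPt (h : ((j : Fin N) → EuclideanSpace ℝ (Fin (n j))) → ℝ)
    (x : ℕ → (j : Fin N) → EuclideanSpace ℝ (Fin (n j))) (k : ℕ) (i : Fin N) :
    bregTwo h i (interPt x k (i + 1)) (interPt x k i)
      = blockBreg h i (interPt x k i) (x (k + 1) i) := by
  simp [bregTwo, blockBreg, interPt_succ]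

/-- The objective is real-valued where all the nonsmooth terms are finite. -/
theorem Phi_eq_coe (f : ((j : Fin N) → EuclideanSpace ℝ (Fin (n j))) → ℝ)
    {g : (i : Fin N) → EuclideanSpace ℝ (Fin (n i)) → EReal}
    {y : (j : Fin N) → EuclideanSpace ℝ (Fin (n j))}
    (htop : ∀ i, g i (y i) ≠ ⊤) (hbot : ∀ i, g i (y i) ≠ ⊥) :
    Phi f g y = ((f y + ∑ i, (g i (y i)).toReal : ℝ) : EReal) := by
  have hsum : ((∑ i, (g i (y i)).toReal : ℝ) : EReal) = ∑ i, g i (y i) := by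
    let coeHom : ℝ →+ EReal := ⟨⟨Real.toEReal, EReal.coe_zero⟩, EReal.coe_add⟩
    refine (map_sum coeHom _ _).trans ?_
    exact Finset.sum_congr rfl fun i _ => EReal.coe_toReal (htop i) (hbot i)
  rw [Phi, EReal.coe_add, hsum]

/-- The values of a function along the intermediate points telescope. -/
theorem sum_interPt_sub (f : ((j : Fin N) → EuclideanSpace ℝ (Fin (n j))) → ℝ)
    (x : ℕ → (j : Fin N) → EuclideanSpace ℝ (Fin (n j))) (k : ℕ) :
    ∑ i : Fin N, (f (interPt x k (i + 1)) - f (interPt x k i)) = f (x (k + 1)) - f (x k) := by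
  rw [Fin.sum_univ_eq_sum_range (fun m => f (interPt x k (m + 1)) - f (interPt x k m)),
    Finset.sum_range_sub (fun m => f (interPt x k m)), interPt_card, interPt_zero]

end Block

/-- Young's inequality for an inertial term, with both norms controlled by `A` and `B`. -/
theorem inertial_inner_le {E : Type*} [NormedAddCommGroup E] [InnerProductSpace ℝ E]
    {a γ σ A B : ℝ} (hγ : 0 < γ) (hσ : 0 < σ) {u v : E}
    (hu : σ / 2 * ‖u‖ ^ 2 ≤ A) (hv : σ / 2 * ‖v‖ ^ 2 ≤ B) :
    a / γ * ⟪u, v⟫ ≤ |a| / (σ * γ) * B + |a| / (σ * γ) * A := by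
  have hinner : |⟪u, v⟫| ≤ (A + B) / σ := by
    rw [le_div_iff₀ hσ]
    have := abs_real_inner_le_norm u v
    nlinarith [sq_nonneg (‖u‖ - ‖v‖)]
  calc a / γ * ⟪u, v⟫ ≤ |a / γ * ⟪u, v⟫| := le_abs_self _
    _ = |a| / γ * |⟪u, v⟫| := by rw [abs_mul, abs_div, abs_of_pos hγ]
    _ ≤ |a| / γ * ((A + B) / σ) := by gcongr
    _ = _ := by field_simp; ring

/-- BIBPA cyclic inequality of the cost over a full cycle. -/
theorem bibpa_cyclic_cost_inequality
    {N : ℕ} {n : Fin N → ℕ}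
    (h : (i : Fin N) → ((j : Fin N) → EuclideanSpace ℝ (Fin (n j))) → ℝ)
    (σ L : Fin N → ℝ) (hσ : ∀ i, 0 < σ i) (hL : ∀ i, 0 < L i)
    (hhdiff : ∀ i, Differentiable ℝ (h i))
    (hstrong : ∀ i x, ConvexOn ℝ Set.univ
      (fun z : EuclideanSpace ℝ (Fin (n i)) =>
        h i (Function.update x i z) - σ i / 2 * ‖z‖ ^ 2))
    (f : ((j : Fin N) → EuclideanSpace ℝ (Fin (n j))) → ℝ)
    (hfdiff : Differentiable ℝ f)
    (hrel : ∀ i x, ConvexOn ℝ Set.univ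
      (fun z : EuclideanSpace ℝ (Fin (n i)) =>
        L i * h i (Function.update x i z) - f (Function.update x i z)))
    (g : (i : Fin N) → EuclideanSpace ℝ (Fin (n i)) → EReal)
    (hgproper : ∀ i, ∃ z, g i z ≠ ⊤) (hgreal : ∀ i z, g i z ≠ ⊥)
    (hglsc : ∀ i, LowerSemicontinuous (g i))
    (x : ℕ → (j : Fin N) → EuclideanSpace ℝ (Fin (n j)))
    (γ α : Fin N → ℕ → ℝ) (hγpos : ∀ i k, 0 < γ i k)
    (hfin : ∀ k i, g i (x k i) ≠ ⊤)
    (hmin : ∀ k, 1 ≤ k → ∀ (i : Fin N) (z : EuclideanSpace ℝ (Fin (n i))),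
      g i (x (k + 1) i)
        + ((⟪blockGrad f i (interPt x k i)
              - (α i k / γ i k) • (x k i - x (k - 1) i), x (k + 1) i - x k i⟫
            + 1 / γ i k * blockBreg (h i) i (interPt x k i) (x (k + 1) i) : ℝ) : EReal)
      ≤ g i z
        + ((⟪blockGrad f i (interPt x k i)
              - (α i k / γ i k) • (x k i - x (k - 1) i), z - x k i⟫
            + 1 / γ i k * blockBreg (h i) i (interPt x k i) z : ℝ) : EReal)) :
    ∀ k, 1 ≤ k →
      Phi f g (x (k + 1)) - Phi f g (x k)
        ≤ ((∑ i : Fin N,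
              ((|α i k| / (σ i * γ i k) - (1 - γ i k * L i) / γ i k)
                  * bregTwo (h i) i (interPt x k (i + 1)) (interPt x k i)
                + |α i k| / (σ i * γ i k)
                  * bregTwo (h i) i (interPt x (k - 1) (i + 1)) (interPt x (k - 1) i))
            : ℝ) : EReal) := by
  intro k hk
  have hbot : ∀ m i, g i (x m i) ≠ ⊥ := fun m i => hgreal i _
  rw [Phi_eq_coe f (hfin _) (hbot _), Phi_eq_coe f (hfin _) (hbot _), ← EReal.coe_sub,
    EReal.coe_le_coe_iff, add_sub_add_comm, ← sum_interPt_sub f x k, ← Finset.sum_sub_distrib,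
    ← Finset.sum_add_distrib]
  refine Finset.sum_le_sum fun i _ => ?_
  have hdescent := le_add_blockBreg_of_relSmooth hfdiff (hhdiff i)
    (hrel i (interPt x k i)) (x (k + 1) i)
  have hstep := sq_norm_le_blockBreg (hhdiff i) (hstrong i (interPt x k i)) (x (k + 1) i)
  have hprev := sq_norm_le_blockBreg (hhdiff i) (hstrong i (interPt x (k - 1) i)) (x k i)
  have hopt := hmin k hk i (x k i)
  have hself : blockBreg (h i) i (interPt x k i) (x k i) = 0 := by
    rw [← interPt_apply_self x k i]
    simp [blockBreg]
  rw [hself, ← EReal.coe_toReal (hfin (k + 1) i) (hbot _ i),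
    ← EReal.coe_toReal (hfin k i) (hbot _ i), ← EReal.coe_add, ← EReal.coe_add,
    EReal.coe_le_coe_iff] at hopt
  simp only [sub_self, inner_zero_right, mul_zero, add_zero, inner_sub_left (blockGrad f i _),
    real_inner_smul_left] at hopt
  rw [bregTwo_interPt, bregTwo_interPt, Nat.sub_add_cancel hk, interPt_succ]
  rw [interPt_apply_self] at hdescent hstep hprev
  have hinertia := inertial_inner_le (a := α i k) (hγpos i k) (hσ i) hprev hstep
  have hcoeff : (1 - γ i k * L i) / γ i k = 1 / γ i k - L i := by
    have := (hγpos i k).ne'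
    field_simp
  rw [hcoeff]
  linarith
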